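/- There exists a constant C > 0 such that for all (ℓ,m) ∈ ℕ×ℤ with |m| ≤ ℓ and all x ∈ [−1,1], |Ỹ_{ℓ,m}(x)| · |x(1−x²)|^{1/6} ≤ C (1+ℓ)^{1/6}. -/

import Mathlib

open MeasureTheory Set
open scoped ENNReal NNReal

noncomputable section

/-- The Legendre polynomial `P_ℓ(x) = (2^ℓ ℓ!)⁻¹ (d/dx)^ℓ (x²−1)^ℓ`. -/
def legendreP (n : ℕ) (x : ℝ) : ℝ :=
  ((2:ℝ)^n * (Nat.factorial n : ℝ))⁻¹ * iteratedDeriv n (fun y => (y^2 - 1)^n) x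

/-- The associated Legendre function `P_ℓ^m` for `0 ≤ m ≤ ℓ`
(on `[-1,1]`, where `√(1-x²)^m = (1-x²)^{m/2}`). -/
def assocP (n m : ℕ) (x : ℝ) : ℝ :=
  (-1:ℝ)^m * Real.sqrt (1 - x^2) ^ m * iteratedDeriv m (legendreP n) x

/-- The associated Legendre function `P_ℓ^m` for integer `m` with `|m| ≤ ℓ`. -/
def assocPZ (n : ℕ) (m : ℤ) (x : ℝ) : ℝ :=
  if 0 ≤ m then assocP n m.toNat x
  else (-1:ℝ)^m.natAbs *
    ((Nat.factorial (n - m.natAbs) : ℝ) / (Nat.factorial (n + m.natAbs) : ℝ)) *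
    assocP n m.natAbs x

/-- `Ỹ_{ℓ,m}(x) = ((2ℓ+1)/(4π) · (ℓ−m)!/(ℓ+m)!)^{1/2} P_ℓ^m(x)`. -/
def tY (n : ℕ) (m : ℤ) (x : ℝ) : ℝ :=
  Real.sqrt (((2*(n:ℝ)+1) / (4*Real.pi)) *
    ((Nat.factorial ((n : ℤ) - m).toNat : ℝ) / (Nat.factorial ((n : ℤ) + m).toNat : ℝ))) *
  assocPZ n m x

/-- A solution `u` of the associated Legendre equation on `(-1, 1)`, regular at both ends, with
turning points `±b` and `L²` norm at most one; `v` is `(1 - x²)` times the derivative of `u`, and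
the equation says that the derivative of `v` is `-lam² (b² - x²) / (1 - x²) u`. -/
structure IsLegendreSolution (lam b : ℝ) (u v : ℝ → ℝ) : Prop where
  lam_pos : 0 < lam
  b_pos : 0 < b
  b_le_one : b ≤ 1
  one_le : 1 ≤ 2 * lam ^ 2 * b ^ 4
  cont_u : Continuous u
  cont_v : Continuous v
  deriv_u : ∀ x ∈ Ioo (-1 : ℝ) 1, HasDerivAt u (v x / (1 - x ^ 2)) x
  deriv_v : ∀ x ∈ Ioo (-1 : ℝ) 1,
    HasDerivAt v (-(lam ^ 2 * (b ^ 2 - x ^ 2) / (1 - x ^ 2)) * u x) x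
  v_one : v 1 = 0
  v_neg_one : v (-1) = 0
  u_one : (1 - b ^ 2) * u 1 = 0
  norm_le : ∫ x in (-1 : ℝ)..1, u x ^ 2 ≤ 1

namespace IsLegendreSolution

variable {lam b : ℝ} {u v : ℝ → ℝ}

/-- The energy `v² + lam² (b² - x²) u²`, nonincreasing on `[0, 1]`. -/
def energy (lam b : ℝ) (u v : ℝ → ℝ) (x : ℝ) : ℝ :=
  v x ^ 2 + lam ^ 2 * (b ^ 2 - x ^ 2) * u x ^ 2

lemma one_sub_sq_pos {x : ℝ} (hx : x ∈ Ioo (-1 : ℝ) 1) : 0 < 1 - x ^ 2 := by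
  nlinarith [hx.1, hx.2]

lemma hasDerivAt_energy (h : IsLegendreSolution lam b u v) {x : ℝ} (hx : x ∈ Ioo (-1 : ℝ) 1) :
    HasDerivAt (energy lam b u v) (-(2 * lam ^ 2 * x * u x ^ 2)) x := by
  have hp := (one_sub_sq_pos hx).ne'
  have h1 := ((h.deriv_v x hx).pow 2).add
    (((((hasDerivAt_id x).pow 2).const_sub (b ^ 2)).const_mul (lam ^ 2)).mul
      ((h.deriv_u x hx).pow 2))
  refine h1.congr_deriv ?_
  simp
  field_simp
  ring

lemma continuous_energy (h : IsLegendreSolution lam b u v) : Continuous (energy lam b u v) := by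
  have := h.cont_u
  have := h.cont_v
  unfold energy
  fun_prop

lemma antitoneOn_energy (h : IsLegendreSolution lam b u v) :
    AntitoneOn (energy lam b u v) (Icc 0 1) := by
  refine antitoneOn_of_hasDerivWithinAt_nonpos (convex_Icc 0 1) h.continuous_energy.continuousOn
    (fun x hx => (h.hasDerivAt_energy ?_).hasDerivWithinAt) (fun x hx => ?_)
  · rw [interior_Icc] at hx
    exact ⟨by linarith [hx.1], hx.2⟩
  · rw [interior_Icc] at hx
    have := hx.1
    simp only [Left.neg_nonpos_iff]
    positivity

lemma energy_one (h : IsLegendreSolution lam b u v) : energy lam b u v 1 = 0 := by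
  unfold energy
  linear_combination (v 1) * h.v_one - lam ^ 2 * u 1 * h.u_one

lemma energy_nonneg (h : IsLegendreSolution lam b u v) {x : ℝ} (hx : x ∈ Icc (0 : ℝ) 1) :
    0 ≤ energy lam b u v x :=
  h.energy_one ▸ h.antitoneOn_energy hx (right_mem_Icc.2 zero_le_one) hx.2

lemma integral_sq_mul_sq_le (h : IsLegendreSolution lam b u v) :
    ∫ x in (-1 : ℝ)..1, x ^ 2 * u x ^ 2 ≤ 4 * b ^ 2 := by
  have cu := h.cont_u
  have cv := h.cont_v
  set X := ∫ x in (-1 : ℝ)..1, x ^ 2 * u x ^ 2 with hX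
  set I := ∫ x in (-1 : ℝ)..1, u x ^ 2 with hI
  have hi (f : ℝ → ℝ) (hf : Continuous f) : IntervalIntegrable f volume (-1) 1 :=
    hf.intervalIntegrable _ _
  have hX0 : 0 ≤ X := intervalIntegral.integral_nonneg (by norm_num) (fun x _ => by positivity)
  have hXI : X ≤ I := by
    refine intervalIntegral.integral_mono_on (by norm_num) (hi _ (by fun_prop))
      (hi _ (by fun_prop)) (fun x hx => ?_)
    have : x ^ 2 ≤ 1 := by nlinarith [hx.1, hx.2]
    nlinarith [sq_nonneg (u x)]
  have hI1 : I ≤ 1 := h.norm_le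
  have key : ∫ x in (-1 : ℝ)..1, (v x ^ 2 - ((lam ^ 2 * b ^ 2 - 1) * u x ^ 2
      - (lam ^ 2 - 3) * (x ^ 2 * u x ^ 2))) = 0 := by
    rw [intervalIntegral.integral_eq_sub_of_hasDerivAt_of_le (by norm_num)
      (f := fun x => (1 - x ^ 2) * (u x * v x) + x * (1 - x ^ 2) * u x ^ 2)
      (by fun_prop) (fun x hx => ?_) (hi _ (by fun_prop))]
    · simp
    · have hp := (one_sub_sq_pos hx).ne'
      have d1 := ((hasDerivAt_id x).pow 2).const_sub 1
      have h1 := (d1.mul ((h.deriv_u x hx).mul (h.deriv_v x hx))).add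
        (((hasDerivAt_id x).mul d1).mul ((h.deriv_u x hx).pow 2))
      refine h1.congr_deriv ?_
      simp
      field_simp
      ring
  rw [intervalIntegral.integral_sub (hi _ (by fun_prop)) (hi _ (by fun_prop)),
    intervalIntegral.integral_sub (hi _ (by fun_prop)) (hi _ (by fun_prop)),
    intervalIntegral.integral_const_mul, intervalIntegral.integral_const_mul, ← hX, ← hI] at key
  have hv : 0 ≤ ∫ x in (-1 : ℝ)..1, v x ^ 2 :=
    intervalIntegral.integral_nonneg (by norm_num) (fun x _ => by positivity)
  have hI0 : 0 ≤ I := hX0.trans hXI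
  rcases le_or_gt 6 (lam ^ 2) with hl | hl
  · have hb := sq_nonneg b
    have : lam ^ 2 / 2 * X ≤ lam ^ 2 * b ^ 2 := by
      nlinarith [mul_nonneg (sq_nonneg lam) hb,
        mul_le_mul_of_nonneg_left hI1 (mul_nonneg (sq_nonneg lam) hb)]
    have : X ≤ 2 * b ^ 2 := by
      by_contra! hc
      nlinarith
    linarith
  · have : 1 / 4 ≤ b ^ 2 := by
      have := h.one_le
      by_contra! hc
      have : b ^ 4 ≤ 1 / 16 := by nlinarith [sq_nonneg b]
      nlinarith [sq_nonneg (b ^ 2)]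
    linarith

lemma energy_zero_le (h : IsLegendreSolution lam b u v) :
    energy lam b u v 0 ≤ 5 * lam ^ 2 * b := by
  have cu := h.cont_u
  have hb := h.b_pos
  have hi (f : ℝ → ℝ) (hf : Continuous f) (a c : ℝ) : IntervalIntegrable f volume a c :=
    hf.intervalIntegrable _ _
  have h1 : ∫ x in (0 : ℝ)..1, -(2 * lam ^ 2 * x * u x ^ 2) = 0 - energy lam b u v 0 := by
    rw [intervalIntegral.integral_eq_sub_of_hasDerivAt_of_le zero_le_one
      h.continuous_energy.continuousOn
      (fun x hx => h.hasDerivAt_energy ⟨by linarith [hx.1], hx.2⟩) (hi _ (by fun_prop) _ _),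
      h.energy_one]
  rw [intervalIntegral.integral_neg] at h1
  have h2 : ∫ x in (0 : ℝ)..1, 2 * lam ^ 2 * x * u x ^ 2 ≤
      ∫ x in (0 : ℝ)..1, (lam ^ 2 * b * u x ^ 2 + lam ^ 2 / b * (x ^ 2 * u x ^ 2)) := by
    refine intervalIntegral.integral_mono_on zero_le_one (hi _ (by fun_prop) _ _)
      (hi _ (by fun_prop) _ _) (fun x _ => ?_)
    have : lam ^ 2 * b * u x ^ 2 + lam ^ 2 / b * (x ^ 2 * u x ^ 2) - 2 * lam ^ 2 * x * u x ^ 2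
        = lam ^ 2 / b * ((b - x) ^ 2 * u x ^ 2) := by
      field_simp
      ring
    have : 0 ≤ lam ^ 2 / b * ((b - x) ^ 2 * u x ^ 2) := by positivity
    linarith
  have h3 : ∫ x in (0 : ℝ)..1, (lam ^ 2 * b * u x ^ 2 + lam ^ 2 / b * (x ^ 2 * u x ^ 2)) ≤
      ∫ x in (-1 : ℝ)..1, (lam ^ 2 * b * u x ^ 2 + lam ^ 2 / b * (x ^ 2 * u x ^ 2)) :=
    intervalIntegral.integral_mono_interval (by norm_num) zero_le_one le_rfl
      (Filter.Eventually.of_forall fun x => by simp only [Pi.zero_apply]; positivity)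
      (hi _ (by fun_prop) _ _)
  have h3' : ∫ x in (-1 : ℝ)..1, (lam ^ 2 * b * u x ^ 2 + lam ^ 2 / b * (x ^ 2 * u x ^ 2)) =
      lam ^ 2 * b * (∫ x in (-1 : ℝ)..1, u x ^ 2) +
        lam ^ 2 / b * ∫ x in (-1 : ℝ)..1, x ^ 2 * u x ^ 2 := by
    rw [intervalIntegral.integral_add (hi _ (by fun_prop) _ _) (hi _ (by fun_prop) _ _),
      intervalIntegral.integral_const_mul, intervalIntegral.integral_const_mul]
  have h4 : lam ^ 2 * b * (∫ x in (-1 : ℝ)..1, u x ^ 2) ≤ lam ^ 2 * b * 1 :=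
    mul_le_mul_of_nonneg_left h.norm_le (by positivity)
  have h5 : lam ^ 2 / b * (∫ x in (-1 : ℝ)..1, x ^ 2 * u x ^ 2) ≤ lam ^ 2 / b * (4 * b ^ 2) :=
    mul_le_mul_of_nonneg_left h.integral_sq_mul_sq_le (by positivity)
  have h6 : lam ^ 2 / b * (4 * b ^ 2) = 4 * lam ^ 2 * b := by field_simp
  linarith

/-- A WKB estimate: `energy / √(b² - x²)` stays comparable to its value at `0` as long as
`√(b² - x²)` varies slowly on the scale of one oscillation. -/
lemma energy_le_of_oscillating (h : IsLegendreSolution lam b u v) {x : ℝ} (hx : x ∈ Ico 0 b)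
    (hosc : 2 * x * (1 - x ^ 2) ≤ lam * √(b ^ 2 - x ^ 2) ^ 3) :
    energy lam b u v x ≤ 14 * lam ^ 2 * √(b ^ 2 - x ^ 2) := by
  have hl := h.lam_pos
  have hb := h.b_pos
  have hb1 := h.b_le_one
  set r : ℝ → ℝ := fun y => √(b ^ 2 - y ^ 2) with hr
  have cr : Continuous r := by fun_prop
  have hr0 : ∀ y ∈ Icc 0 x, 0 < r y := fun y hy =>
    Real.sqrt_pos.2 (by nlinarith [hy.1, hy.2, hx.2])
  have hr2 : ∀ y ∈ Icc 0 x, r y ^ 2 = b ^ 2 - y ^ 2 := fun y hy =>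
    Real.sq_sqrt (by nlinarith [hy.1, hy.2, hx.2])
  have dr : ∀ y ∈ Icc 0 x, HasDerivAt r (-y / r y) y := by
    intro y hy
    have h0 : b ^ 2 - y ^ 2 ≠ 0 := by nlinarith [hr2 y hy, hr0 y hy]
    refine ((((hasDerivAt_id y).pow 2).const_sub (b ^ 2)).sqrt h0).congr_deriv ?_
    have := (hr0 y hy).ne'
    simp only [hr] at this ⊢
    simp
    field_simp
  set R : ℝ → ℝ := fun y => 2 * y * (1 - y ^ 2) / (lam * r y ^ 3) with hR
  set R' : ℝ → ℝ := fun y => 2 * (b ^ 2 * (1 - y ^ 2) + 2 * y ^ 2 * (1 - b ^ 2)) /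
    (lam * r y ^ 5) with hR'
  have dR : ∀ y ∈ Icc 0 x, HasDerivAt R (R' y) y := by
    intro y hy
    have h0 := (hr0 y hy).ne'
    have hne : lam * r y ^ 3 ≠ 0 := by positivity
    refine ((((hasDerivAt_id y).const_mul 2).mul (((hasDerivAt_id y).pow 2).const_sub 1)).div
      (((dr y hy).pow 3).const_mul lam) hne).congr_deriv ?_
    simp [hR']
    field_simp
    have := hr2 y hy
    have e : b ^ 2 = r y ^ 2 + y ^ 2 := by linarith
    simp only [e]
    ring
  have hsub : ∀ y ∈ Icc 0 x, y ∈ Ioo (-1 : ℝ) 1 := fun y hy =>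
    ⟨by linarith [hy.1], by linarith [hy.2, hx.2]⟩
  have hR'0 : ∀ y ∈ Icc 0 x, 0 ≤ R' y := by
    intro y hy
    have h1 := one_sub_sq_pos (hsub y hy)
    have h2 := hr0 y hy
    have h3 : 0 ≤ 1 - b ^ 2 := by nlinarith
    simp only [hR']
    positivity
  have hRm : MonotoneOn R (Icc 0 x) := by
    refine monotoneOn_of_hasDerivWithinAt_nonneg (convex_Icc 0 x)
      (fun y hy => (dR y hy).continuousAt.continuousWithinAt)
      (fun y hy => (dR y (interior_subset hy)).hasDerivWithinAt)
      (fun y hy => hR'0 y (interior_subset hy))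
  have hx0 : x ∈ Icc 0 x := right_mem_Icc.2 hx.1
  have h00 : (0 : ℝ) ∈ Icc 0 x := left_mem_Icc.2 hx.1
  have hR1 : ∀ y ∈ Icc 0 x, R y ≤ 1 := by
    intro y hy
    refine (hRm hy hx0 hy.2).trans ?_
    have := hr0 x hx0
    simp only [hR]
    rw [div_le_one (by positivity)]
    exact hosc
  have hR0 : ∀ y ∈ Icc 0 x, 0 ≤ R y := by
    intro y hy
    have h1 := one_sub_sq_pos (hsub y hy)
    have h2 := hr0 y hy
    have h3 := hy.1
    simp only [hR]
    positivity
  set G : ℝ → ℝ := fun y => energy lam b u v y / (lam * r y) with hG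
  have hEr : ∀ y ∈ Icc 0 x, energy lam b u v y = v y ^ 2 + (lam * r y * u y) ^ 2 := by
    intro y hy
    simp only [energy, ← hr2 y hy]
    ring
  have huv : ∀ y ∈ Icc 0 x, |u y * v y| ≤ G y / 2 := by
    intro y hy
    have h2 := hr0 y hy
    simp only [hG]
    rw [hEr y hy, div_div, le_div_iff₀ (by positivity), abs_mul, ← sq_abs (v y),
      ← sq_abs (lam * r y * u y), abs_mul (lam * r y), abs_of_pos (mul_pos hl h2)]
    nlinarith [sq_nonneg (|v y| - lam * r y * |u y|)]
  set H : ℝ → ℝ := fun y => (G y - R y / 2 * (u y * v y)) * (2 - R y) with hH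
  have dH : ∀ y ∈ Icc 0 x,
      HasDerivAt H (-(R' y * (G y + (1 - R y) * (u y * v y)))) y := by
    intro y hy
    have h0 := (hr0 y hy).ne'
    have hp := (one_sub_sq_pos (hsub y hy)).ne'
    have hne : lam * r y ≠ 0 := by positivity
    have dG := (h.hasDerivAt_energy (hsub y hy)).div ((dr y hy).const_mul lam) hne
    have duv := (h.deriv_u y (hsub y hy)).mul (h.deriv_v y (hsub y hy))
    have dF : HasDerivAt (fun y => G y - R y / 2 * (u y * v y)) (-(R' y / 2 * (u y * v y))) y := by
      refine (dG.sub (((dR y hy).div_const 2).mul duv)).congr_deriv ?_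
      rw [hEr y hy, ← hr2 y hy]
      simp only [hR, hR', Pi.mul_apply]
      field_simp
      ring
    refine (dF.mul ((dR y hy).const_sub 2)).congr_deriv ?_
    ring
  have hHa : AntitoneOn H (Icc 0 x) := by
    refine antitoneOn_of_hasDerivWithinAt_nonpos (convex_Icc 0 x)
      (fun y hy => (dH y hy).continuousAt.continuousWithinAt)
      (fun y hy => (dH y (interior_subset hy)).hasDerivWithinAt)
      (fun y hy => ?_)
    have hy := interior_subset hy
    have h1 := hR'0 y hy
    have h2 := hR1 y hy
    have h3 := hR0 y hy
    have h4 := abs_le.1 (huv y hy)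
    simp only [Left.neg_nonpos_iff]
    refine mul_nonneg h1 ?_
    nlinarith
  have h1 := hHa h00 hx0 hx.1
  have hG0 : G 0 ≤ 5 * lam := by
    have : r 0 = b := by simp [hr, Real.sqrt_sq hb.le]
    simp only [hG, this]
    rw [div_le_iff₀ (by positivity)]
    linarith [h.energy_zero_le]
  have hH0 : H 0 = 2 * G 0 := by
    simp [hH, hR]
    ring
  have h2 := hR1 x hx0
  have h3 := hR0 x hx0
  have h4 := abs_le.1 (huv x hx0)
  have hGx : 3 / 4 * G x ≤ H x := by
    have : 3 / 4 * G x ≤ G x - R x / 2 * (u x * v x) := by nlinarith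
    have : 0 ≤ G x := by linarith
    simp only [hH]
    nlinarith
  have hfin : G x ≤ 14 * lam := by linarith
  have h5 := hr0 x hx0
  simp only [hG] at hfin
  rw [div_le_iff₀ (by positivity)] at hfin
  linarith

lemma bound_of_oscillating (h : IsLegendreSolution lam b u v) {x : ℝ} (hx : x ∈ Ico 0 b)
    (hosc : 2 * x * (1 - x ^ 2) ≤ lam * √(b ^ 2 - x ^ 2) ^ 3) :
    x * (1 - x ^ 2) * u x ^ 6 ≤ 1372 * lam := by
  have hE := h.energy_le_of_oscillating hx hosc
  have hl := h.lam_pos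
  have hp := one_sub_sq_pos (x := x) ⟨by linarith [hx.1], by linarith [hx.2, h.b_le_one]⟩
  have hx0 := hx.1
  have hq : 0 < b ^ 2 - x ^ 2 := by nlinarith [hx.1, hx.2]
  have hr2 := Real.sq_sqrt hq.le
  have hr := Real.sqrt_pos.2 hq
  set r := √(b ^ 2 - x ^ 2)
  have h1 : lam ^ 2 * r ^ 2 * u x ^ 2 ≤ 14 * lam ^ 2 * r := by
    rw [hr2]
    refine le_trans ?_ hE
    simp only [energy]
    linarith [sq_nonneg (v x)]
  have h2 : r * u x ^ 2 ≤ 14 := by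
    have : lam ^ 2 * r * (r * u x ^ 2) ≤ lam ^ 2 * r * 14 := by linarith
    exact le_of_mul_le_mul_left this (by positivity)
  have h3 : (r * u x ^ 2) ^ 3 ≤ 14 ^ 3 := pow_le_pow_left₀ (by positivity) h2 3
  have h4 : 2 * x * (1 - x ^ 2) * u x ^ 6 ≤ lam * r ^ 3 * u x ^ 6 :=
    mul_le_mul_of_nonneg_right hosc (by positivity)
  have h5 : lam * (r * u x ^ 2) ^ 3 ≤ lam * 14 ^ 3 := mul_le_mul_of_nonneg_left h3 hl.le
  linarith [show lam * (r * u x ^ 2) ^ 3 = lam * r ^ 3 * u x ^ 6 by ring]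

lemma one_sub_sq_le_of_transition {x₁ r : ℝ} (hl : 0 < lam) (hr : 0 < r)
    (hp : 0 < 1 - x₁ ^ 2) (hb1 : 1 ≤ lam ^ 2 * (1 - b ^ 2)) (hr2 : r ^ 2 = b ^ 2 - x₁ ^ 2)
    (hsq : lam ^ 2 * r ^ 6 = 4 * x₁ ^ 2 * (1 - x₁ ^ 2) ^ 2) :
    1 - x₁ ^ 2 ≤ 17 * (1 - b ^ 2) := by
  have hx₁1 : x₁ ^ 2 ≤ 1 := by linarith
  rcases le_or_gt (r ^ 2) (1 - b ^ 2) with hs | hs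
  · linarith
  · have h1 : 1 - x₁ ^ 2 ≤ 2 * r ^ 2 := by linarith
    have h2 : (1 - x₁ ^ 2) ^ 2 ≤ (2 * r ^ 2) ^ 2 := pow_le_pow_left₀ hp.le h1 2
    have h3 : r ^ 4 * (lam ^ 2 * r ^ 2) ≤ r ^ 4 * 16 := by
      nlinarith [sq_nonneg x₁, sq_nonneg (1 - x₁ ^ 2)]
    have h4 : lam ^ 2 * r ^ 2 ≤ 16 := le_of_mul_le_mul_left h3 (by positivity)
    have h5 : lam ^ 2 * r ^ 2 ≤ lam ^ 2 * (16 * (1 - b ^ 2)) := by linarith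
    have h6 := le_of_mul_le_mul_left h5 (by positivity)
    linarith

lemma le_four_mul_of_transition {x₁ r : ℝ} (hb : 0 < b) (hx₁0 : 0 ≤ x₁)
    (hp : 0 < 1 - x₁ ^ 2) (hone : 1 ≤ 2 * lam ^ 2 * b ^ 4) (hr2 : r ^ 2 = b ^ 2 - x₁ ^ 2)
    (hsq : lam ^ 2 * r ^ 6 = 4 * x₁ ^ 2 * (1 - x₁ ^ 2) ^ 2) :
    b ≤ 4 * x₁ := by
  by_contra! hc
  have h1 : 15 / 16 * b ^ 2 ≤ r ^ 2 := by nlinarith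
  have h2 : (15 / 16 * b ^ 2) ^ 3 ≤ (r ^ 2) ^ 3 := pow_le_pow_left₀ (by positivity) h1 3
  have h3 : (1 - x₁ ^ 2) ^ 2 ≤ 1 := by nlinarith
  have h4 : 4 * x₁ ^ 2 * (1 - x₁ ^ 2) ^ 2 ≤ b ^ 2 / 4 := by nlinarith [sq_nonneg x₁]
  have h5 : lam ^ 2 * (15 / 16 * b ^ 2) ^ 3 ≤ lam ^ 2 * (r ^ 2) ^ 3 :=
    mul_le_mul_of_nonneg_left h2 (sq_nonneg _)
  have h6 : b ^ 2 * 1 ≤ b ^ 2 * (2 * lam ^ 2 * b ^ 4) :=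
    mul_le_mul_of_nonneg_left hone (sq_nonneg _)
  nlinarith [pow_pos hb 2]

/-- The bound between a point `x₁` where the oscillatory regime ends and the turning point `b`. -/
lemma bound_of_transition (h : IsLegendreSolution lam b u v) (hb1 : 1 ≤ lam ^ 2 * (1 - b ^ 2))
    {x₁ : ℝ} (hx₁ : x₁ ∈ Ico 0 b)
    (heq : 2 * x₁ * (1 - x₁ ^ 2) = lam * √(b ^ 2 - x₁ ^ 2) ^ 3) {x : ℝ} (hx : x ∈ Icc x₁ b) :
    x * (1 - x ^ 2) * u x ^ 6 ≤ 2 * 4536 ^ 3 * lam := by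
  have hE := h.energy_le_of_oscillating hx₁ heq.le
  have hl := h.lam_pos
  have hb := h.b_pos
  have hd : 0 < 1 - b ^ 2 := by
    by_contra! hc
    nlinarith [sq_nonneg lam]
  have hblt : b < 1 := by nlinarith
  have hx₁0 := hx₁.1
  have hq : 0 < b ^ 2 - x₁ ^ 2 := by nlinarith [hx₁.1, hx₁.2]
  have hr2 := Real.sq_sqrt hq.le
  have hr := Real.sqrt_pos.2 hq
  set r := √(b ^ 2 - x₁ ^ 2)
  have hE0 : 0 ≤ energy lam b u v x₁ := h.energy_nonneg ⟨hx₁0, by linarith [hx₁.2]⟩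
  have hsE := Real.sq_sqrt hE0
  have hsE0 := Real.sqrt_nonneg (energy lam b u v x₁)
  set e := √(energy lam b u v x₁)
  have hv : ∀ y ∈ Icc x₁ b, |v y| ≤ e := by
    intro y hy
    have h1 : energy lam b u v y ≤ energy lam b u v x₁ :=
      h.antitoneOn_energy ⟨hx₁0, by linarith [hx₁.2]⟩ ⟨hx₁0.trans hy.1, by linarith [hy.2]⟩ hy.1
    have h2 : 0 ≤ lam ^ 2 * (b ^ 2 - y ^ 2) * u y ^ 2 := by
      have : 0 ≤ b ^ 2 - y ^ 2 := by nlinarith [hy.1, hy.2]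
      positivity
    refine abs_le_of_sq_le_sq ?_ hsE0
    rw [hsE]
    refine le_trans ?_ h1
    simp only [energy]
    linarith
  have hu1 : lam * r * |u x₁| ≤ e := by
    refine le_of_sq_le_sq ?_ hsE0
    rw [hsE, mul_pow, mul_pow, sq_abs, hr2]
    simp only [energy]
    linarith [sq_nonneg (v x₁)]
  have hmv : |u x - u x₁| ≤ e / (1 - b ^ 2) * (x - x₁) := by
    have hI : ∀ y ∈ Icc x₁ b, y ∈ Ioo (-1 : ℝ) 1 := fun y hy =>
      ⟨by linarith [hy.1], by linarith [hy.2]⟩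
    have := (convex_Icc x₁ b).norm_image_sub_le_of_norm_hasDerivWithin_le (f := u)
      (C := e / (1 - b ^ 2))
      (fun y hy => (h.deriv_u y (hI y hy)).hasDerivWithinAt) (fun y hy => ?_)
      (left_mem_Icc.2 hx₁.2.le) hx
    · rwa [Real.norm_eq_abs, Real.norm_eq_abs, abs_of_nonneg (sub_nonneg.2 hx.1)] at this
    · rw [Real.norm_eq_abs, abs_div, abs_of_pos (one_sub_sq_pos (hI y hy))]
      exact div_le_div₀ hsE0 (hv y hy) hd (by nlinarith [hy.1, hy.2])
  have hp := one_sub_sq_pos (x := x₁) ⟨by linarith, by linarith [hx₁.2]⟩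
  have hsq : lam ^ 2 * r ^ 6 = 4 * x₁ ^ 2 * (1 - x₁ ^ 2) ^ 2 := by
    linear_combination (-(lam * r ^ 3) - 2 * x₁ * (1 - x₁ ^ 2)) * heq
  have hcmp : 1 - x₁ ^ 2 ≤ 17 * (1 - b ^ 2) := one_sub_sq_le_of_transition hl hr hp hb1 hr2 hsq
  have hlen : lam * r * (x - x₁) ≤ 17 * (1 - b ^ 2) := by
    have h1 : (x - x₁) * (b + x₁) ≤ r ^ 2 := by
      rw [hr2]
      nlinarith [hx.1, hx.2]
    have h2 : lam * r * ((x - x₁) * (b + x₁)) ≤ lam * r * r ^ 2 := by gcongr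
    have h3 : 2 * x₁ * (1 - x₁ ^ 2) ≤ (b + x₁) * (1 - x₁ ^ 2) :=
      mul_le_mul_of_nonneg_right (by linarith [hx₁.2]) hp.le
    have h4 : (b + x₁) * (lam * r * (x - x₁)) ≤ (b + x₁) * (1 - x₁ ^ 2) := by linarith
    exact (le_of_mul_le_mul_left h4 (by linarith)).trans hcmp
  have hu : lam * r * |u x| ≤ 18 * e := by
    have h1 : |u x| ≤ |u x₁| + e / (1 - b ^ 2) * (x - x₁) := by
      linarith [abs_sub_abs_le_abs_sub (u x) (u x₁)]
    have h2 : lam * r * (e / (1 - b ^ 2) * (x - x₁)) ≤ 17 * e := by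
      rw [show lam * r * (e / (1 - b ^ 2) * (x - x₁)) = e * (lam * r * (x - x₁)) / (1 - b ^ 2) by
        ring, div_le_iff₀ hd]
      nlinarith
    have h3 := mul_le_mul_of_nonneg_left h1 (mul_pos hl hr).le
    linarith
  have hu2 : r * u x ^ 2 ≤ 4536 := by
    have h1 : (lam * r * |u x|) ^ 2 ≤ (18 * e) ^ 2 := pow_le_pow_left₀ (by positivity) hu 2
    rw [mul_pow, mul_pow, sq_abs, mul_pow, hsE] at h1
    have : lam ^ 2 * r * (r * u x ^ 2) ≤ lam ^ 2 * r * 4536 := by linarith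
    exact le_of_mul_le_mul_left this (by positivity)
  have hbx : b ≤ 4 * x₁ :=
    le_four_mul_of_transition hb hx₁0 hp h.one_le hr2 hsq
  have hw : x * (1 - x ^ 2) ≤ 2 * lam * r ^ 3 := by
    have h1 : 1 - x ^ 2 ≤ 1 - x₁ ^ 2 := by nlinarith [hx.1]
    have h2 : x * (1 - x ^ 2) ≤ 4 * x₁ * (1 - x₁ ^ 2) :=
      mul_le_mul (hx.2.trans hbx) h1 (by nlinarith [hx.1, hx.2]) (by linarith)
    linarith
  have h3 : (r * u x ^ 2) ^ 3 ≤ 4536 ^ 3 := pow_le_pow_left₀ (by positivity) hu2 3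
  have h4 : x * (1 - x ^ 2) * u x ^ 6 ≤ 2 * lam * r ^ 3 * u x ^ 6 :=
    mul_le_mul_of_nonneg_right hw (by positivity)
  have h5 : lam * (r * u x ^ 2) ^ 3 ≤ lam * 4536 ^ 3 := mul_le_mul_of_nonneg_left h3 hl.le
  linarith [show lam * (r * u x ^ 2) ^ 3 = lam * r ^ 3 * u x ^ 6 by ring]

lemma mul_nonpos_of_exterior (h : IsLegendreSolution lam b u v) {x : ℝ} (hx : x ∈ Icc b 1) :
    u x * v x ≤ 0 := by
  have hb := h.b_pos
  have cu := h.cont_u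
  have cv := h.cont_v
  have hm : MonotoneOn (fun y => u y * v y) (Icc b 1) := by
    have hsub : ∀ y ∈ interior (Icc b 1), b < y ∧ y ∈ Ioo (-1 : ℝ) 1 := by
      intro y hy
      rw [interior_Icc] at hy
      exact ⟨hy.1, by linarith [hy.1], hy.2⟩
    refine monotoneOn_of_hasDerivWithinAt_nonneg (convex_Icc b 1) (by fun_prop)
      (fun y hy => ((h.deriv_u y (hsub y hy).2).mul (h.deriv_v y (hsub y hy).2)).hasDerivWithinAt)
      (fun y hy => ?_)
    obtain ⟨h1, h2⟩ := hsub y hy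
    have hp := one_sub_sq_pos h2
    have h3 : 0 ≤ y ^ 2 - b ^ 2 := by nlinarith
    have : v y / (1 - y ^ 2) * v y + u y * (-(lam ^ 2 * (b ^ 2 - y ^ 2) / (1 - y ^ 2)) * u y) =
        (v y ^ 2 + lam ^ 2 * (y ^ 2 - b ^ 2) * u y ^ 2) / (1 - y ^ 2) := by
      field_simp
      ring
    rw [this]
    positivity
  simpa [h.v_one] using hm hx (right_mem_Icc.2 h.b_le_one) hx.2

lemma antitoneOn_sq_exterior (h : IsLegendreSolution lam b u v) :
    AntitoneOn (fun x => u x ^ 2) (Icc b 1) := by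
  have hb := h.b_pos
  have cu := h.cont_u
  have hsub : ∀ y ∈ interior (Icc b 1), y ∈ Icc b 1 ∧ y ∈ Ioo (-1 : ℝ) 1 := by
    intro y hy
    rw [interior_Icc] at hy
    exact ⟨Ioo_subset_Icc_self hy, by linarith [hy.1], hy.2⟩
  refine antitoneOn_of_hasDerivWithinAt_nonpos (convex_Icc b 1) (by fun_prop)
      (fun y hy => ((h.deriv_u y (hsub y hy).2).pow 2).hasDerivWithinAt)
      (fun y hy => ?_)
  have hp := one_sub_sq_pos (hsub y hy).2
  have h1 := h.mul_nonpos_of_exterior (hsub y hy).1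
  have : ((2 : ℕ) : ℝ) * u y ^ (2 - 1) * (v y / (1 - y ^ 2)) = 2 * (u y * v y) / (1 - y ^ 2) := by
    simp
    ring
  rw [this]
  exact div_nonpos_of_nonpos_of_nonneg (by linarith) hp.le

lemma antitoneOn_mul_pow_exterior (h : IsLegendreSolution lam b u v) :
    AntitoneOn (fun x => x * u x ^ 6) (Icc (2 * b) 1) := by
  have hb := h.b_pos
  have cu := h.cont_u
  have hl := h.lam_pos
  have hsub : ∀ y ∈ interior (Icc (2 * b) 1), y ∈ Icc (2 * b) 1 ∧ y ∈ Ioo (-1 : ℝ) 1 := by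
    intro y hy
    rw [interior_Icc] at hy
    exact ⟨Ioo_subset_Icc_self hy, by linarith [hy.1], hy.2⟩
  refine antitoneOn_of_hasDerivWithinAt_nonpos (convex_Icc _ 1) (by fun_prop)
      (fun y hy => ((hasDerivAt_id y).mul
        ((h.deriv_u y (hsub y hy).2).pow 6)).hasDerivWithinAt)
      (fun y hy => ?_)
  obtain ⟨⟨hy1, hy2⟩, hy3⟩ := hsub y hy
  have hp := one_sub_sq_pos hy3
  have h1 := h.mul_nonpos_of_exterior (x := y) ⟨by linarith, hy2⟩
  have h2 : 0 ≤ energy lam b u v y := h.energy_nonneg ⟨by linarith, hy2⟩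
  have hsq : u y ^ 2 ≤ -(6 * y * (u y * v y)) := by
    refine le_of_sq_le_sq ?_ ?_
    · have h3 : 3 * b ^ 2 ≤ y ^ 2 - b ^ 2 := by nlinarith
      have h4 : 4 * b ^ 2 ≤ y ^ 2 := by nlinarith
      have h5 : lam ^ 2 * (y ^ 2 - b ^ 2) * u y ^ 2 ≤ v y ^ 2 := by
        simp only [energy] at h2
        linarith
      have h6 : lam ^ 2 * (3 * b ^ 2) * u y ^ 2 ≤ v y ^ 2 := by
        refine le_trans ?_ h5
        gcongr
      have h7 : 4 * b ^ 2 * (lam ^ 2 * (3 * b ^ 2) * u y ^ 2) ≤ y ^ 2 * v y ^ 2 := by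
        gcongr
      have h8 : u y ^ 2 * 1 ≤ u y ^ 2 * (2 * lam ^ 2 * b ^ 4) := by
        gcongr
        exact h.one_le
      have h9 : u y ^ 2 ≤ 36 * (y ^ 2 * v y ^ 2) := by
        have : 0 ≤ u y ^ 2 * (2 * lam ^ 2 * b ^ 4) := by positivity
        linarith
      have h10 : u y ^ 2 * u y ^ 2 ≤ u y ^ 2 * (36 * (y ^ 2 * v y ^ 2)) := by gcongr
      linarith
    · nlinarith
  have : (1 : ℝ) * u y ^ 6 + id y * (((6 : ℕ) : ℝ) * u y ^ (6 - 1) * (v y / (1 - y ^ 2))) =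
      u y ^ 4 * (u y ^ 2 * (1 - y ^ 2) + 6 * y * (u y * v y)) / (1 - y ^ 2) := by
    simp
    field_simp
  simp only [Pi.pow_apply]
  rw [this]
  refine div_nonpos_of_nonpos_of_nonneg (mul_nonpos_of_nonneg_of_nonpos (by positivity) ?_) hp.le
  nlinarith [sq_nonneg (u y), sq_nonneg y]

lemma bound_of_exterior (h : IsLegendreSolution lam b u v) {x : ℝ} (hx : x ∈ Icc b 1) :
    x * (1 - x ^ 2) * u x ^ 6 ≤ 2 * (b * (1 - b ^ 2) * u b ^ 6) := by
  have hb := h.b_pos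
  have hx0 : 0 < x := hb.trans_le hx.1
  have key : ∀ y ∈ Icc b 1, y ≤ 2 * b → y * u y ^ 6 ≤ 2 * b * u b ^ 6 := by
    intro y hy hyb
    have h1 := h.antitoneOn_sq_exterior (left_mem_Icc.2 h.b_le_one) hy hy.1
    have h2 : (u y ^ 2) ^ 3 ≤ (u b ^ 2) ^ 3 := pow_le_pow_left₀ (by positivity) h1 3
    have h3 : u y ^ 6 ≤ u b ^ 6 := by linarith [pow_mul (u y) 2 3, pow_mul (u b) 2 3]
    gcongr
  have hmain : x * u x ^ 6 ≤ 2 * b * u b ^ 6 := by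
    rcases le_total x (2 * b) with hxb | hxb
    · exact key x hx hxb
    · exact (h.antitoneOn_mul_pow_exterior ⟨le_rfl, hxb.trans hx.2⟩ ⟨hxb, hx.2⟩ hxb).trans
        (key (2 * b) ⟨by linarith, hxb.trans hx.2⟩ le_rfl)
  have h1 : 0 ≤ 1 - x ^ 2 := by nlinarith [hx.2]
  have h2 : 1 - x ^ 2 ≤ 1 - b ^ 2 := by nlinarith [hx.1]
  have h3 := mul_le_mul h2 hmain (by positivity) (by linarith)
  linarith

theorem bound_of_lt_one (h : IsLegendreSolution lam b u v) (hb1 : 1 ≤ lam ^ 2 * (1 - b ^ 2))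
    {x : ℝ} (hx : x ∈ Icc (0 : ℝ) 1) :
    x * (1 - x ^ 2) * u x ^ 6 ≤ 4 * 4536 ^ 3 * lam := by
  have hl := h.lam_pos
  have hb := h.b_pos
  have hbl := h.b_le_one
  have hd : 0 < 1 - b ^ 2 := by
    by_contra! hc
    nlinarith [sq_nonneg lam]
  have interior : ∀ y ∈ Icc 0 b, y * (1 - y ^ 2) * u y ^ 6 ≤ 2 * 4536 ^ 3 * lam := by
    intro y hy
    rcases le_or_gt (2 * y * (1 - y ^ 2)) (lam * √(b ^ 2 - y ^ 2) ^ 3) with hosc | hosc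
    · have hyb : y < b := by
        refine lt_of_le_of_ne hy.2 fun hyb => ?_
        subst hyb
        simp at hosc
        nlinarith
      linarith [h.bound_of_oscillating ⟨hy.1, hyb⟩ hosc]
    · obtain ⟨x₁, hx₁, heq⟩ := intermediate_value_Icc hy.1
        (f := fun z => 2 * z * (1 - z ^ 2) - lam * √(b ^ 2 - z ^ 2) ^ 3) (by fun_prop)
        (show (0 : ℝ) ∈ _ from ⟨by simp; positivity, by linarith⟩)
      have heq : 2 * x₁ * (1 - x₁ ^ 2) - lam * √(b ^ 2 - x₁ ^ 2) ^ 3 = 0 := heq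
      have hx₁b : x₁ < b := by
        refine lt_of_le_of_ne (hx₁.2.trans hy.2) fun hyb => ?_
        subst hyb
        simp at heq
        rcases heq with heq | heq <;> linarith
      exact h.bound_of_transition hb1 ⟨hx₁.1, hx₁b⟩ (by linarith) ⟨hx₁.2, hy.2⟩
  rcases le_total x b with hxb | hxb
  · linarith [interior x ⟨hx.1, hxb⟩]
  · linarith [h.bound_of_exterior ⟨hxb, hx.2⟩, interior b (right_mem_Icc.2 hb.le)]

theorem bound_of_eq_one (h : IsLegendreSolution lam 1 u v) (hu : ∀ x ∈ Icc (0 : ℝ) 1, u x ^ 2 ≤ lam)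
    {x : ℝ} (hx : x ∈ Icc (0 : ℝ) 1) :
    x * (1 - x ^ 2) * u x ^ 6 ≤ 1372 * lam := by
  have hl := h.lam_pos
  have hx0 := hx.1
  rcases hx.2.eq_or_lt with rfl | hx1
  · norm_num [hl.le]
  rcases le_or_gt (2 * x * (1 - x ^ 2)) (lam * √(1 ^ 2 - x ^ 2) ^ 3) with hosc | hosc
  · exact h.bound_of_oscillating ⟨hx.1, hx1⟩ hosc
  have hp : 0 < 1 - x ^ 2 := one_sub_sq_pos ⟨by linarith, hx1⟩
  rw [one_pow] at hosc
  have hr := Real.sqrt_pos.2 hp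
  have hr2 := Real.sq_sqrt hp.le
  set r := √(1 - x ^ 2)
  have h1 : lam * r ≤ 2 := by
    rw [← hr2] at hosc
    have : r ^ 2 * (lam * r) ≤ r ^ 2 * (2 * x) := by linarith
    linarith [le_of_mul_le_mul_left this (by positivity)]
  have h2 : (u x ^ 2) ^ 3 ≤ lam ^ 3 := pow_le_pow_left₀ (by positivity) (hu x hx) 3
  have h3 : (lam * r) ^ 2 ≤ 2 ^ 2 := pow_le_pow_left₀ (by positivity) h1 2
  calc x * (1 - x ^ 2) * u x ^ 6 ≤ 1 * (1 - x ^ 2) * lam ^ 3 := by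
        rw [show u x ^ 6 = (u x ^ 2) ^ 3 by ring]
        gcongr
    _ = lam * (lam * r) ^ 2 := by rw [← hr2]; ring
    _ ≤ lam * 2 ^ 2 := by gcongr
    _ ≤ 1372 * lam := by linarith

end IsLegendreSolution

open Polynomial in
lemma iteratedDeriv_polynomial_eval (p : ℝ[X]) (k : ℕ) :
    iteratedDeriv k (fun x => p.eval x) = fun x => (derivative^[k] p).eval x := by
  induction k generalizing p with
  | zero => simp
  | succ k ih =>
    rw [iteratedDeriv_succ', Function.iterate_succ_apply, ← ih]
    congr 1
    ext x
    simp

open Polynomial in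
lemma iterate_derivative_natDegree_eq_C (p : ℝ[X]) :
    derivative^[p.natDegree] p = C ((p.natDegree.factorial : ℝ) * p.leadingCoeff) := by
  have h : (derivative^[p.natDegree] p).natDegree ≤ 0 := by
    simpa using natDegree_iterate_derivative p p.natDegree
  rw [eq_C_of_natDegree_le_zero h, coeff_iterate_derivative]
  simp [Nat.descFactorial_self]

open Polynomial in
/-- The Legendre polynomial as an element of `ℝ[X]`, given by Rodrigues' formula. -/
def legendrePoly (n : ℕ) : ℝ[X] :=
  C ((2 ^ n * (n.factorial : ℝ))⁻¹) * derivative^[n] ((X ^ 2 - 1) ^ n)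

open Polynomial in
lemma legendreP_eq_eval (n : ℕ) : legendreP n = fun x => (legendrePoly n).eval x := by
  ext x
  have h := congrFun (iteratedDeriv_polynomial_eval ((X ^ 2 - 1) ^ n) n) x
  simp only [eval_pow, eval_sub, eval_X, eval_one] at h
  simp [legendreP, legendrePoly, h]

/-- The `k`-th derivative of the `n`-th Legendre polynomial. -/
def legendreDeriv (n k : ℕ) (x : ℝ) : ℝ :=
  ((Polynomial.derivative)^[k] (legendrePoly n)).eval x

lemma iteratedDeriv_legendreP (n k : ℕ) : iteratedDeriv k (legendreP n) = legendreDeriv n k := by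
  rw [legendreP_eq_eval, iteratedDeriv_polynomial_eval]
  rfl

@[fun_prop]
lemma continuous_legendreDeriv (n k : ℕ) : Continuous (legendreDeriv n k) :=
  Polynomial.continuous _

lemma hasDerivAt_legendreDeriv (n k : ℕ) (x : ℝ) :
    HasDerivAt (legendreDeriv n k) (legendreDeriv n (k + 1) x) x := by
  simp only [legendreDeriv, Function.iterate_succ_apply']
  exact Polynomial.hasDerivAt _ x

open Polynomial in
lemma rodrigues_recurrence (n j : ℕ) :
    (X ^ 2 - 1) * derivative^[j + 2] ((X ^ 2 - 1 : ℝ[X]) ^ n) =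
      2 * ((n : ℝ[X]) - (j : ℝ[X]) - 1) * X * derivative^[j + 1] ((X ^ 2 - 1) ^ n) +
      ((j : ℝ[X]) + 1) * (2 * (n : ℝ[X]) - (j : ℝ[X])) * derivative^[j] ((X ^ 2 - 1) ^ n) := by
  induction j with
  | zero =>
    have h : (X ^ 2 - 1) * derivative ((X ^ 2 - 1 : ℝ[X]) ^ n) =
        2 * (n : ℝ[X]) * X * (X ^ 2 - 1) ^ n := by
      cases n with
      | zero => simp
      | succ n =>
        rw [derivative_pow]
        simp
        ring
    have h' := congrArg derivative h
    simp only [derivative_mul, derivative_sub, derivative_X_sq, derivative_one, derivative_X,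
      derivative_natCast, derivative_ofNat] at h'
    simp only [Function.iterate_succ_apply', Function.iterate_zero_apply]
    simp only [map_ofNat] at h'
    push_cast
    linear_combination h'
  | succ j ih =>
    have h' := congrArg derivative ih
    simp only [derivative_mul, derivative_sub, derivative_add, derivative_X_sq, derivative_one,
      derivative_X, derivative_natCast, derivative_ofNat, ← Function.iterate_succ_apply'] at h'
    simp only [map_ofNat] at h'
    push_cast
    linear_combination h'

lemma legendreDeriv_ode (n k : ℕ) (x : ℝ) :
    (1 - x ^ 2) * legendreDeriv n (k + 2) x = 2 * (k + 1) * x * legendreDeriv n (k + 1) x -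
      (n - k) * (n + k + 1) * legendreDeriv n k x := by
  have h := congrArg (Polynomial.eval x) (rodrigues_recurrence n (n + k))
  simp only [legendreDeriv, legendrePoly, Polynomial.iterate_derivative_C_mul,
    Polynomial.eval_mul, Polynomial.eval_C, ← Function.iterate_add_apply]
  simp only [Polynomial.eval_mul, Polynomial.eval_add, Polynomial.eval_sub, Polynomial.eval_pow,
    Polynomial.eval_X, Polynomial.eval_one, Polynomial.eval_natCast, Polynomial.eval_ofNat] at h
  push_cast at h
  rw [show k + 2 + n = n + k + 2 by ring, show k + 1 + n = n + k + 1 by ring, add_comm k n]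
  linear_combination (-(2 ^ n * (n.factorial : ℝ))⁻¹) * h

open Polynomial in
lemma legendreDeriv_self (n : ℕ) (x : ℝ) :
    legendreDeriv n n x = (2 * n).factorial / (2 ^ n * n.factorial) := by
  have hm : ((X ^ 2 - 1 : ℝ[X]) ^ n).Monic := by
    refine Monic.pow ?_ n
    simpa using monic_X_pow_sub_C (1 : ℝ) two_ne_zero
  have hd : ((X ^ 2 - 1 : ℝ[X]) ^ n).natDegree = 2 * n := by
    rw [natDegree_pow, ← C_1, natDegree_X_pow_sub_C, mul_comm]
  have h := iterate_derivative_natDegree_eq_C ((X ^ 2 - 1 : ℝ[X]) ^ n)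
  rw [hm.leadingCoeff, hd] at h
  simp only [legendreDeriv, legendrePoly, iterate_derivative_C_mul, ← Function.iterate_add_apply,
    ← two_mul, h]
  simp
  ring

lemma factorial_mul_of_recurrence (n : ℕ) (a : ℕ → ℝ)
    (ha : ∀ k < n, a (k + 1) = (n - k) * (n + k + 1) * a k) (k : ℕ) (hk : k ≤ n) :
    ((n - k).factorial : ℝ) * a k = (n + k).factorial * a 0 := by
  induction k with
  | zero => simp
  | succ k ih =>
    have h := ih (by omega)
    obtain ⟨d, rfl⟩ := Nat.exists_eq_add_of_lt hk
    rw [ha k hk]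
    rw [show k + d + 1 - k = d + 1 by omega, Nat.factorial_succ] at h
    rw [show k + d + 1 - (k + 1) = d by omega, ← add_assoc, Nat.factorial_succ]
    push_cast at h ⊢
    linear_combination (k + d + 1 + k + 1 : ℝ) * h

lemma legendreDeriv_zero_one (n : ℕ) : legendreDeriv n 0 1 = 1 := by
  have h := factorial_mul_of_recurrence n
    (fun k => 2 ^ k * k.factorial * legendreDeriv n k 1) (fun k _ => ?_) n le_rfl
  · rw [legendreDeriv_self, ← two_mul] at h
    simp only [Nat.sub_self, Nat.factorial_zero] at h
    have h1 : ((2 * n).factorial : ℝ) ≠ 0 := by positivity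
    have h2 : (n.factorial : ℝ) ≠ 0 := by positivity
    field_simp at h
    simpa using h.symm
  · have := legendreDeriv_ode n k 1
    simp only [Nat.factorial_succ, pow_succ]
    push_cast
    linear_combination (-(2 ^ k * (k.factorial : ℝ))) * this

lemma factorial_mul_integral_one_sub_sq_pow (n : ℕ) :
    ((2 * n + 1).factorial : ℝ) * ∫ x in (-1 : ℝ)..1, (1 - x ^ 2) ^ n =
      2 * (2 ^ n * n.factorial) ^ 2 := by
  induction n with
  | zero => norm_num
  | succ n ih =>
    have hi (f : ℝ → ℝ) (hf : Continuous f) : IntervalIntegrable f volume (-1) 1 :=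
      hf.intervalIntegrable _ _
    have h : ∫ x in (-1 : ℝ)..1, ((2 * n + 3 : ℝ) * (1 - x ^ 2) ^ (n + 1) -
        (2 * (n + 1) : ℝ) * (1 - x ^ 2) ^ n) = 0 := by
      rw [intervalIntegral.integral_eq_sub_of_hasDerivAt
        (f := fun x => x * (1 - x ^ 2) ^ (n + 1)) (fun x _ => ?_) (hi _ (by fun_prop))]
      · simp
      · refine ((hasDerivAt_id x).mul
          ((((hasDerivAt_id x).pow 2).const_sub 1).pow (n + 1))).congr_deriv ?_
        simp
        ring
    rw [intervalIntegral.integral_sub (hi _ (by fun_prop)) (hi _ (by fun_prop)),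
      intervalIntegral.integral_const_mul, intervalIntegral.integral_const_mul] at h
    rw [show 2 * (n + 1) + 1 = 2 * n + 1 + 1 + 1 by ring, Nat.factorial_succ (2 * n + 1 + 1),
      Nat.factorial_succ (2 * n + 1), Nat.factorial_succ n]
    push_cast
    linear_combination (2 * n + 2 : ℝ) * ((2 * n + 1).factorial : ℝ) * h +
      (2 * n + 2 : ℝ) ^ 2 * ih

lemma integral_legendreDeriv_succ (n k : ℕ) :
    ∫ x in (-1 : ℝ)..1, (1 - x ^ 2) ^ (k + 1) * legendreDeriv n (k + 1) x ^ 2 =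
      ((n : ℝ) - k) * (n + k + 1) * ∫ x in (-1 : ℝ)..1, (1 - x ^ 2) ^ k * legendreDeriv n k x ^ 2 := by
  have hi (f : ℝ → ℝ) (hf : Continuous f) : IntervalIntegrable f volume (-1) 1 :=
    hf.intervalIntegrable _ _
  have h : ∫ x in (-1 : ℝ)..1, ((1 - x ^ 2) ^ (k + 1) * legendreDeriv n (k + 1) x ^ 2 -
      (n - k : ℝ) * (n + k + 1) * ((1 - x ^ 2) ^ k * legendreDeriv n k x ^ 2)) = 0 := by
    rw [intervalIntegral.integral_eq_sub_of_hasDerivAt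
      (f := fun x => (1 - x ^ 2) ^ (k + 1) * (legendreDeriv n k x * legendreDeriv n (k + 1) x))
      (fun x _ => ?_) (hi _ (by fun_prop))]
    · simp
    · refine (((((hasDerivAt_id x).pow 2).const_sub 1).pow (k + 1)).mul
        ((hasDerivAt_legendreDeriv n k x).mul
          (hasDerivAt_legendreDeriv n (k + 1) x))).congr_deriv ?_
      simp
      linear_combination (1 - x ^ 2) ^ k * legendreDeriv n k x * legendreDeriv_ode n k x
  rw [intervalIntegral.integral_sub (hi _ (by fun_prop)) (hi _ (by fun_prop)),
    intervalIntegral.integral_const_mul] at h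
  linarith

lemma integral_legendreDeriv_sq (n k : ℕ) (hk : k ≤ n) :
    ((2 * n + 1 : ℝ) * (n - k).factorial) *
      ∫ x in (-1 : ℝ)..1, (1 - x ^ 2) ^ k * legendreDeriv n k x ^ 2 = 2 * (n + k).factorial := by
  have hrec := factorial_mul_of_recurrence n
    (fun k => ∫ x in (-1 : ℝ)..1, (1 - x ^ 2) ^ k * legendreDeriv n k x ^ 2)
    (fun k _ => integral_legendreDeriv_succ n k)
  have h0 : (2 * n + 1 : ℝ) *
      (∫ x in (-1 : ℝ)..1, (1 - x ^ 2) ^ 0 * legendreDeriv n 0 x ^ 2) = 2 := by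
    have h := hrec n le_rfl
    simp only [legendreDeriv_self, intervalIntegral.integral_mul_const, ← two_mul] at h
    have h1 := factorial_mul_integral_one_sub_sq_pow n
    rw [Nat.factorial_succ] at h1
    push_cast at h1
    have h2 : ((2 * n).factorial : ℝ) ≠ 0 := by positivity
    have h3 : (n.factorial : ℝ) ≠ 0 := by positivity
    simp only [Nat.sub_self, Nat.factorial_zero, Nat.cast_one, one_mul] at h
    set A := ∫ x in (-1 : ℝ)..1, (1 - x ^ 2) ^ 0 * legendreDeriv n 0 x ^ 2
    set B := ∫ x in (-1 : ℝ)..1, (1 - x ^ 2) ^ n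
    have h4 : ((2 * n).factorial : ℝ) * B = (2 ^ n * n.factorial) ^ 2 * A := by
      field_simp at h
      linarith
    have h5 : ((2 : ℝ) ^ n * n.factorial) ^ 2 * ((2 * n + 1) * A) =
        (2 ^ n * n.factorial) ^ 2 * 2 := by
      linear_combination h1 - (2 * n + 1 : ℝ) * h4
    exact mul_left_cancel₀ (by positivity) h5
  linear_combination (2 * n + 1 : ℝ) * hrec k hk + ((n + k).factorial : ℝ) * h0

lemma legendreDeriv_zero_sq_le (n : ℕ) (hn : 0 < n) {x : ℝ} (hx : x ∈ Icc (0 : ℝ) 1) :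
    legendreDeriv n 0 x ^ 2 ≤ 1 := by
  have hm : MonotoneOn (fun y => (1 - y ^ 2) * legendreDeriv n 1 y ^ 2 +
      n * (n + 1) * legendreDeriv n 0 y ^ 2) (Icc 0 1) := by
    refine monotoneOn_of_hasDerivWithinAt_nonneg (f' := fun y => 2 * y * legendreDeriv n 1 y ^ 2)
      (convex_Icc 0 1) (by fun_prop) (fun y _ => HasDerivAt.hasDerivWithinAt ?_) (fun y hy => ?_)
    · refine (((((hasDerivAt_id y).pow 2).const_sub 1).mul
        ((hasDerivAt_legendreDeriv n 1 y).pow 2)).add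
        (((hasDerivAt_legendreDeriv n 0 y).pow 2).const_mul (n * (n + 1) : ℝ))).congr_deriv ?_
      have h := legendreDeriv_ode n 0 y
      simp only [zero_add, Nat.cast_zero] at h
      simp
      linear_combination 2 * legendreDeriv n 1 y * h
    · have := (interior_subset hy).1
      positivity
  have h := hm hx (right_mem_Icc.2 zero_le_one) hx.2
  simp only [legendreDeriv_zero_one] at h
  have h1 : 0 ≤ (1 - x ^ 2) * legendreDeriv n 1 x ^ 2 :=
    mul_nonneg (by nlinarith [hx.1, hx.2]) (sq_nonneg _)
  have h2 : (n * (n + 1) : ℝ) * legendreDeriv n 0 x ^ 2 ≤ n * (n + 1) * 1 := by linarith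
  exact le_of_mul_le_mul_left h2 (by positivity)

lemma hasDerivAt_sqrt_one_sub_sq_pow (k : ℕ) {x : ℝ} (hx : 0 < 1 - x ^ 2) :
    HasDerivAt (fun y => √(1 - y ^ 2) ^ k) (-(k * x * √(1 - x ^ 2) ^ k / (1 - x ^ 2))) x := by
  cases k with
  | zero => simpa using hasDerivAt_const x (1 : ℝ)
  | succ k =>
    refine (((((hasDerivAt_id x).pow 2).const_sub 1).sqrt hx.ne').pow (k + 1)).congr_deriv ?_
    have h1 := (Real.sqrt_pos.2 hx).ne'
    have h2 := Real.sq_sqrt hx.le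
    simp only [id, Nat.add_sub_cancel, Nat.cast_add, Nat.cast_one, Nat.cast_ofNat, mul_one, pow_one,
      Pi.pow_apply, Nat.reduceSub]
    generalize √(1 - x ^ 2) = s at *
    rw [← h2]
    field_simp
    ring

/-- The normalized associated Legendre function, up to sign. -/
def normLegendre (n m : ℕ) (x : ℝ) : ℝ :=
  √(((2 * (n : ℝ) + 1) / (4 * Real.pi)) * ((n - m).factorial / (n + m).factorial)) *
    (√(1 - x ^ 2) ^ m * legendreDeriv n m x)

/-- `(1 - x ^ 2)` times the derivative of `normLegendre n m`. -/
def normLegendreDeriv (n m : ℕ) (x : ℝ) : ℝ :=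
  √(((2 * (n : ℝ) + 1) / (4 * Real.pi)) * ((n - m).factorial / (n + m).factorial)) *
    (√(1 - x ^ 2) ^ m * ((1 - x ^ 2) * legendreDeriv n (m + 1) x - m * x * legendreDeriv n m x))

lemma sqrt_one_sub_sq_sq_pow (m : ℕ) {x : ℝ} (hx : x ∈ Icc (-1 : ℝ) 1) :
    (√(1 - x ^ 2) ^ m) ^ 2 = (1 - x ^ 2) ^ m := by
  rw [← pow_mul, mul_comm, pow_mul, Real.sq_sqrt (by nlinarith [hx.1, hx.2])]

lemma integral_normLegendre_sq (n m : ℕ) (hm : m ≤ n) :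
    ∫ x in (-1 : ℝ)..1, normLegendre n m x ^ 2 = 1 / (2 * Real.pi) := by
  have h1 : ∫ x in (-1 : ℝ)..1, normLegendre n m x ^ 2 = ∫ x in (-1 : ℝ)..1,
      ((2 * (n : ℝ) + 1) / (4 * Real.pi)) * ((n - m).factorial / (n + m).factorial) *
        ((1 - x ^ 2) ^ m * legendreDeriv n m x ^ 2) := by
    refine intervalIntegral.integral_congr fun x hx => ?_
    rw [uIcc_of_le (by norm_num)] at hx
    simp only [normLegendre]
    rw [mul_pow, Real.sq_sqrt (by positivity), mul_pow, sqrt_one_sub_sq_sq_pow m hx]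
  rw [h1, intervalIntegral.integral_const_mul]
  have h2 := integral_legendreDeriv_sq n m hm
  have h3 : ((n + m).factorial : ℝ) ≠ 0 := by positivity
  have := Real.pi_ne_zero
  field_simp
  linear_combination 2 * h2

lemma isLegendreSolution_normLegendre {n m : ℕ} (hn : 0 < n) (hm : m ≤ n) :
    IsLegendreSolution √(n * (n + 1)) √(1 - m ^ 2 / (n * (n + 1)))
      (normLegendre n m) (normLegendreDeriv n m) := by
  have hn1 : (1 : ℝ) ≤ n := by exact_mod_cast hn
  have hmn : (m : ℝ) ≤ n := by exact_mod_cast hm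
  have hL : (0 : ℝ) < n * (n + 1) := by positivity
  have hm2 : (m : ℝ) ^ 2 ≤ n ^ 2 := pow_le_pow_left₀ (by positivity) hmn 2
  have hb : 0 < 1 - (m : ℝ) ^ 2 / (n * (n + 1)) := by
    rw [sub_pos, div_lt_one hL]
    nlinarith
  have hlam2 := Real.sq_sqrt hL.le
  have hb2 := Real.sq_sqrt hb.le
  have hmu : (1 - (1 - (m : ℝ) ^ 2 / (n * (n + 1)))) = m ^ 2 / (n * (n + 1)) := by ring
  refine ⟨Real.sqrt_pos.2 hL, Real.sqrt_pos.2 hb, ?_, ?_, ?_, ?_, ?_, ?_, ?_, ?_, ?_, ?_⟩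
  · refine Real.sqrt_le_one.2 ?_
    linarith [show 0 ≤ (m : ℝ) ^ 2 / (n * (n + 1)) by positivity]
  · rw [hlam2, show 4 = 2 * 2 by norm_num, pow_mul, hb2]
    have h1 : 1 - (m : ℝ) ^ 2 / (n * (n + 1)) ≥ n / (n * (n + 1)) := by
      rw [ge_iff_le, le_sub_iff_add_le, ← add_div, div_le_one hL]
      nlinarith
    calc (1 : ℝ) ≤ 2 * n / (n + 1) := by rw [le_div_iff₀ (by positivity)]; linarith
      _ = 2 * (n * (n + 1)) * (n / (n * (n + 1))) ^ 2 := by field_simp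
      _ ≤ _ := by gcongr
  · unfold normLegendre
    fun_prop
  · unfold normLegendreDeriv
    fun_prop
  · intro x hx
    have hp := IsLegendreSolution.one_sub_sq_pos hx
    refine (((hasDerivAt_sqrt_one_sub_sq_pow m hp).mul
      (hasDerivAt_legendreDeriv n m x)).const_mul _).congr_deriv ?_
    simp only [normLegendreDeriv]
    field_simp
    ring
  · intro x hx
    have hp := IsLegendreSolution.one_sub_sq_pos hx
    have d1 := ((((hasDerivAt_id x).pow 2).const_sub 1).mul
      (hasDerivAt_legendreDeriv n (m + 1) x)).sub
      (((hasDerivAt_id x).const_mul (m : ℝ)).mul (hasDerivAt_legendreDeriv n m x))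
    refine (((hasDerivAt_sqrt_one_sub_sq_pow m hp).mul d1).const_mul _).congr_deriv ?_
    have h := legendreDeriv_ode n m x
    have h' : legendreDeriv n (m + 1 + 1) x = (2 * (m + 1) * x * legendreDeriv n (m + 1) x -
      (n - m) * (n + m + 1) * legendreDeriv n m x) / (1 - x ^ 2) := by
      rw [eq_div_iff hp.ne', ← h]
      ring
    simp only [normLegendre, hlam2, hb2, h']
    simp
    field_simp
    ring
  · simp [normLegendreDeriv]
    rcases m.eq_zero_or_pos with rfl | h0
    · simp
    · simp [h0.ne']
  · simp [normLegendreDeriv]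
    rcases m.eq_zero_or_pos with rfl | h0
    · simp
    · simp [h0.ne']
  · rw [hb2, hmu]
    rcases m.eq_zero_or_pos with rfl | h0
    · simp
    · simp [normLegendre, h0.ne']
  · rw [integral_normLegendre_sq n m hm, div_le_one (by positivity)]
    linarith [Real.pi_gt_three]

lemma normLegendre_bound_of_nonneg {n m : ℕ} (hm : m ≤ n) {x : ℝ} (hx : x ∈ Icc (0 : ℝ) 1) :
    x * (1 - x ^ 2) * normLegendre n m x ^ 6 ≤ 4 * 4536 ^ 3 * (1 + n) := by
  rcases n.eq_zero_or_pos with rfl | hn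
  · obtain rfl : m = 0 := by omega
    have h1 : normLegendre 0 0 x ^ 2 ≤ 1 := by
      have hpi := Real.pi_gt_three
      simp only [normLegendre, legendreDeriv_self]
      rw [mul_pow, Real.sq_sqrt (by positivity)]
      norm_num
      rw [← one_div, div_mul_eq_mul_div, div_le_one (by positivity)]
      linarith
    have h2 : (normLegendre 0 0 x ^ 2) ^ 3 ≤ 1 := pow_le_one₀ (by positivity) h1
    have h3 : 0 ≤ 1 - x ^ 2 := by nlinarith [hx.1, hx.2]
    have h4 : x * (1 - x ^ 2) ≤ 1 := by nlinarith [hx.1, hx.2, sq_nonneg x]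
    have h5 : x * (1 - x ^ 2) * (normLegendre 0 0 x ^ 2) ^ 3 ≤ 1 :=
      mul_le_one₀ h4 (by positivity) h2
    rw [← pow_mul] at h5
    norm_num at h5 ⊢
    linarith
  · have h := isLegendreSolution_normLegendre hn hm
    have hn1 : (1 : ℝ) ≤ n := by exact_mod_cast hn
    have hL : (0 : ℝ) < n * (n + 1) := by positivity
    have hlam : √((n : ℝ) * (n + 1)) ≤ 1 + n := Real.sqrt_le_iff.2 ⟨by positivity, by nlinarith⟩
    have hlam' : (n : ℝ) ≤ √((n : ℝ) * (n + 1)) := Real.le_sqrt_of_sq_le (by nlinarith)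
    rcases m.eq_zero_or_pos with rfl | h0
    · simp only [Nat.cast_zero, ne_eq, OfNat.ofNat_ne_zero, not_false_eq_true, zero_pow,
        zero_div, sub_zero, Real.sqrt_one] at h
      have hb := h.bound_of_eq_one (fun y hy => ?_) hx
      · linarith
      · refine le_trans ?_ hlam'
        have hpi := Real.pi_gt_three
        have hfac : ((n - 0).factorial : ℝ) / (n + 0).factorial = 1 := by
          simp [Nat.factorial_ne_zero]
        simp only [normLegendre, hfac, pow_zero, one_mul, mul_one]
        rw [mul_pow, Real.sq_sqrt (by positivity)]
        calc (2 * (n : ℝ) + 1) / (4 * Real.pi) * legendreDeriv n 0 y ^ 2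
            ≤ (2 * (n : ℝ) + 1) / (4 * Real.pi) * 1 := by
              gcongr
              exact legendreDeriv_zero_sq_le n hn hy
          _ ≤ n := by
              rw [mul_one, div_le_iff₀ (by positivity)]
              nlinarith
    · have hm1 : (1 : ℝ) ≤ m := by exact_mod_cast h0
      have hb := h.bound_of_lt_one ?_ hx
      · linarith
      · have hmn : (m : ℝ) ≤ n := by exact_mod_cast hm
        rw [Real.sq_sqrt hL.le, Real.sq_sqrt]
        · rw [show (n * (n + 1) : ℝ) * (1 - (1 - m ^ 2 / (n * (n + 1)))) = m ^ 2 by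
            field_simp; ring]
          exact one_le_pow₀ hm1
        · rw [sub_nonneg, div_le_one hL]
          nlinarith

lemma legendreDeriv_neg (n k : ℕ) (x : ℝ) :
    legendreDeriv n k (-x) = (-1) ^ (n + k) * legendreDeriv n k x := by
  have h : legendreP n = fun x => (-1) ^ n * legendreP n (-x) := by
    ext y
    have h1 := iteratedDeriv_comp_neg n (fun y : ℝ => (y ^ 2 - 1) ^ n) y
    simp only [neg_sq, smul_eq_mul] at h1
    simp only [legendreP, h1]
    ring
  induction k generalizing x with
  | zero =>
    have h0 : legendreDeriv n 0 = legendreP n := by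
      rw [← iteratedDeriv_legendreP, iteratedDeriv_zero]
    have h1 := congrFun h (-x)
    rwa [neg_neg, ← h0] at h1
  | succ k ih =>
    have h1 := (hasDerivAt_legendreDeriv n k (-x)).comp x (hasDerivAt_neg x)
    have h2 := (hasDerivAt_legendreDeriv n k x).const_mul ((-1) ^ (n + k))
    have h3 : legendreDeriv n k ∘ Neg.neg = fun y => (-1) ^ (n + k) * legendreDeriv n k y :=
      funext fun y => ih y
    rw [h3] at h1
    linear_combination -h1.unique h2

lemma abs_normLegendre_neg (n m : ℕ) (x : ℝ) :
    |normLegendre n m (-x)| = |normLegendre n m x| := by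
  simp [normLegendre, legendreDeriv_neg, abs_mul]

lemma abs_tY (n : ℕ) (m : ℤ) (hm : m.natAbs ≤ n) (x : ℝ) :
    |tY n m x| = |normLegendre n m.natAbs x| := by
  obtain ⟨k, rfl | rfl⟩ := m.eq_nat_or_neg
  · simp only [Int.natAbs_natCast] at hm ⊢
    have h1 : ((n : ℤ) - k).toNat = n - k := by omega
    have h2 : ((n : ℤ) + k).toNat = n + k := by omega
    simp [tY, assocPZ, assocP, normLegendre, iteratedDeriv_legendreP, h1, h2, abs_mul, mul_assoc]
  · simp only [Int.natAbs_neg, Int.natAbs_natCast] at hm ⊢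
    rcases k.eq_zero_or_pos with rfl | hk
    · have h0 : legendreP n = legendreDeriv n 0 := by
        rw [← iteratedDeriv_legendreP, iteratedDeriv_zero]
      simp [tY, assocPZ, assocP, normLegendre, h0, abs_mul]
    have h1 : ((n : ℤ) - -k).toNat = n + k := by omega
    have h2 : ((n : ℤ) + -k).toNat = n - k := by omega
    have h3 : ¬ (0 : ℤ) ≤ -k := by omega
    have key : √((2 * (n : ℝ) + 1) / (4 * Real.pi) * ((n + k).factorial / (n - k).factorial)) *
        ((n - k).factorial / (n + k).factorial) =
        √((2 * (n : ℝ) + 1) / (4 * Real.pi) * ((n - k).factorial / (n + k).factorial)) := by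
      have h4 : (0 : ℝ) ≤ (n - k).factorial / (n + k).factorial := by positivity
      rw [← Real.sqrt_sq h4, ← Real.sqrt_mul (by positivity), Real.sqrt_sq h4]
      congr 1
      field_simp
    simp only [tY, assocPZ, assocP, normLegendre, iteratedDeriv_legendreP, h1, h2, if_neg h3,
      Int.natAbs_neg, Int.natAbs_natCast, ← key]
    simp [abs_mul, mul_assoc]

lemma normLegendre_bound {n m : ℕ} (hm : m ≤ n) {x : ℝ} (hx : x ∈ Icc (-1 : ℝ) 1) :
    |normLegendre n m x| ^ 6 * |x * (1 - x ^ 2)| ≤ 4 * 4536 ^ 3 * (1 + n) := by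
  have hax : |x| ∈ Icc (0 : ℝ) 1 := ⟨abs_nonneg x, abs_le.2 hx⟩
  have h1 : |normLegendre n m x| = |normLegendre n m (|x|)| := by
    rcases abs_choice x with h | h <;> rw [h]
    exact (abs_normLegendre_neg n m x).symm
  have h2 : |x * (1 - x ^ 2)| = |x| * (1 - |x| ^ 2) := by
    rw [abs_mul, sq_abs, abs_of_nonneg (show 0 ≤ 1 - x ^ 2 by nlinarith [hx.1, hx.2])]
  have h3 := normLegendre_bound_of_nonneg hm hax
  rw [h1, h2, Even.pow_abs (by decide)]
  linarith

/-- the uniform bound `|Ỹ_{ℓ,m}(x)| |x(1−x²)|^{1/6} ≤ C (1+ℓ)^{1/6}`. -/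
theorem statement9 :
    ∃ C : ℝ, 0 < C ∧ ∀ (n : ℕ) (m : ℤ), m.natAbs ≤ n → ∀ x : ℝ, x ∈ Set.Icc (-1 : ℝ) 1 →
      |tY n m x| * |x * (1 - x^2)| ^ ((1:ℝ)/6) ≤ C * (1 + (n:ℝ)) ^ ((1:ℝ)/6) := by
  refine ⟨(4 * 4536 ^ 3) ^ ((1 : ℝ) / 6), by positivity, fun n m hm x hx => ?_⟩
  rw [abs_tY n m hm, ← Real.mul_rpow (by positivity) (by positivity)]
  have h := Real.rpow_le_rpow (by positivity) (normLegendre_bound hm hx)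
    (show (0 : ℝ) ≤ 1 / 6 by norm_num)
  refine le_trans (le_of_eq ?_) h
  rw [Real.mul_rpow (by positivity) (by positivity), ← Real.rpow_natCast _ 6,
    ← Real.rpow_mul (by positivity)]
  norm_num
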